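/- arXiv:1811.04331 — 6 statements merged into one kernel-verified Lean document; each statement's English description precedes it below -/
import Mathlib

section
/- Let X be a finite ground set, O a finite set of objects, and for each unordered pair {i,j} of objects (allowing i = j) let C(i,j) ⊆ X; for O' ⊆ O set c(O') = |⋃_{i,j ∈ O'} C(i,j)|. Let k and t be integers with 2 ≤ t ≤ k, let O* ⊆ O with |O*| = k, and let O' ⊆ O be any subset. Let Y_t = { Z ⊆ O* : |Z| = t and Z \ O' ≠ ∅ }. Then binom(k-2, t-2) · (c(O*) − c(O')) ≤ Σ_{Z ∈ Y_t} ( c(O' ∪ Z) − c(O') ). -/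
/-- The double coverage `c(O') = |⋃_{i,j ∈ O'} C(i,j)|` of a set of objects. -/
def dblCov {X O : Type*} [DecidableEq X] (C : O → O → Finset X) (T : Finset O) : ℕ :=
  (T.biUnion fun i => T.biUnion fun j => C i j).card

/-- The ground elements covered by pairs of objects of `T`. -/
def dblCover {X O : Type*} [DecidableEq X] (C : O → O → Finset X) (T : Finset O) : Finset X :=
  T.biUnion fun i => T.biUnion fun j => C i j

theorem card_dblCover {X O : Type*} [DecidableEq X] (C : O → O → Finset X) (T : Finset O) :
    (dblCover C T).card = dblCov C T := rfl

theorem mem_dblCover {X O : Type*} [DecidableEq X] {C : O → O → Finset X} {T : Finset O} {x : X} :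
    x ∈ dblCover C T ↔ ∃ i ∈ T, ∃ j ∈ T, x ∈ C i j := by
  simp [dblCover]

theorem dblCover_mono {X O : Type*} [DecidableEq X] (C : O → O → Finset X) {S T : Finset O}
    (h : S ⊆ T) : dblCover C S ⊆ dblCover C T := by
  intro x hx
  obtain ⟨i, hi, j, hj, hx⟩ := mem_dblCover.1 hx
  exact mem_dblCover.2 ⟨i, h hi, j, h hj, hx⟩

/-- A set `P ⊆ S` has at least `(|S| - |P|).choose (t - |P|)` supersets of size `t` in `S`. -/
theorem choose_le_card_filter_superset {O : Type*} [DecidableEq O] {P S : Finset O} {t : ℕ}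
    (hPS : P ⊆ S) (ht : P.card ≤ t) :
    (S.card - P.card).choose (t - P.card) ≤ ((S.powersetCard t).filter (P ⊆ ·)).card := by
  rw [← Finset.card_sdiff_of_subset hPS, ← Finset.card_powersetCard]
  refine Finset.card_le_card_of_injOn (· ∪ P) ?_ ?_
  · intro W hW
    obtain ⟨hWS, hWc⟩ := Finset.mem_powersetCard.1 hW
    have hd : Disjoint W P := Finset.disjoint_of_subset_left hWS Finset.sdiff_disjoint
    refine Finset.mem_filter.2 ⟨Finset.mem_powersetCard.2 ⟨?_, ?_⟩, Finset.subset_union_right⟩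
    · exact Finset.union_subset (hWS.trans Finset.sdiff_subset) hPS
    · rw [Finset.card_union_of_disjoint hd, hWc]
      omega
  · intro W hW V hV h
    have disj : ∀ {A : Finset O}, A ∈ (S \ P).powersetCard (t - P.card) → Disjoint A P :=
      fun hA => Finset.disjoint_of_subset_left (Finset.mem_powersetCard.1 hA).1
        Finset.sdiff_disjoint
    rw [← Finset.union_sdiff_cancel_right (disj hW), ← Finset.union_sdiff_cancel_right (disj hV)]
    exact congrArg (· \ P) h

/-- A ground element covered by `S` but not by `T` is covered by at least
`(|S| - 2).choose (t - 2)` of the sets `T ∪ Z`, with `Z` a `t`-subset of `S` not inside `T`. -/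
theorem choose_le_card_filter_mem_dblCover {X O : Type*} [DecidableEq X] [DecidableEq O]
    (C : O → O → Finset X) {S T : Finset O} {t : ℕ} (ht : 2 ≤ t) (hS : 2 ≤ S.card) {x : X}
    (hx : x ∈ dblCover C S \ dblCover C T) :
    (S.card - 2).choose (t - 2) ≤
      ((S.powerset.filter fun Z => Z.card = t ∧ (Z \ T).Nonempty).filter
        fun Z => x ∈ dblCover C (T ∪ Z)).card := by
  obtain ⟨hxS, hxT⟩ := Finset.mem_sdiff.1 hx
  obtain ⟨i, hi, j, hj, hij⟩ := mem_dblCover.1 hxS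
  obtain ⟨P, hP, hPS, hPc⟩ := Finset.exists_subsuperset_card_eq
    (Finset.insert_subset hi (Finset.singleton_subset_iff.2 hj)) (Finset.card_le_two) hS
  have hiP : i ∈ P := hP (by simp)
  have hjP : j ∈ P := hP (by simp)
  have h := choose_le_card_filter_superset hPS (hPc.trans_le ht)
  rw [hPc] at h
  refine h.trans (Finset.card_le_card fun Z hZ => ?_)
  obtain ⟨hZ, hPZ⟩ := Finset.mem_filter.1 hZ
  obtain ⟨hZS, hZc⟩ := Finset.mem_powersetCard.1 hZ
  have hxZ : x ∈ dblCover C Z := mem_dblCover.2 ⟨i, hPZ hiP, j, hPZ hjP, hij⟩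
  refine Finset.mem_filter.2 ⟨Finset.mem_filter.2 ⟨Finset.mem_powerset.2 hZS, hZc, ?_⟩,
    dblCover_mono C Finset.subset_union_right hxZ⟩
  exact Finset.sdiff_nonempty.2 fun hZT => hxT (dblCover_mono C hZT hxZ)

/-- counting inequality over the family `Y_t` of `t`-subsets of the optimum
containing a fresh object. -/
theorem stmt0 {X O : Type*} [Fintype X] [DecidableEq X] [Fintype O] [DecidableEq O]
    (C : O → O → Finset X) (hC : ∀ i j : O, C i j = C j i)
    (k t : ℕ) (ht : 2 ≤ t) (htk : t ≤ k)
    (Ostar : Finset O) (hOstar : Ostar.card = k) (O' : Finset O) :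
    (Nat.choose (k - 2) (t - 2) : ℤ) * ((dblCov C Ostar : ℤ) - (dblCov C O' : ℤ)) ≤
      ∑ Z ∈ Ostar.powerset.filter (fun Z => Z.card = t ∧ (Z \ O').Nonempty),
        ((dblCov C (O' ∪ Z) : ℤ) - (dblCov C O' : ℤ)) := by
  set Y := Ostar.powerset.filter fun Z => Z.card = t ∧ (Z \ O').Nonempty
  set A := dblCover C Ostar \ dblCover C O'
  have hA : (dblCov C Ostar : ℤ) - dblCov C O' ≤ A.card := by
    have : (dblCover C Ostar).card - (dblCover C O').card ≤ A.card :=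
      Finset.le_card_sdiff (dblCover C O') (dblCover C Ostar)
    rw [card_dblCover, card_dblCover] at this
    omega
  have hcount : A.card * (k - 2).choose (t - 2) ≤
      ∑ Z ∈ Y, (A.filter fun x => x ∈ dblCover C (O' ∪ Z)).card := by
    rw [← smul_eq_mul]
    refine (Finset.card_nsmul_le_sum A
      (fun x => (Y.filter fun Z => x ∈ dblCover C (O' ∪ Z)).card) _ fun x hx => ?_).trans_eq
      (Finset.sum_card_bipartiteAbove_eq_sum_card_bipartiteBelow
        fun x Z => x ∈ dblCover C (O' ∪ Z))
    rw [← hOstar]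
    exact choose_le_card_filter_mem_dblCover C ht (by omega) hx
  calc ((k - 2).choose (t - 2) : ℤ) * ((dblCov C Ostar : ℤ) - dblCov C O')
      ≤ (k - 2).choose (t - 2) * A.card := by gcongr
    _ ≤ ∑ Z ∈ Y, ((A.filter fun x => x ∈ dblCover C (O' ∪ Z)).card : ℤ) := by
        rw [mul_comm]
        exact_mod_cast hcount
    _ ≤ ∑ Z ∈ Y, ((dblCov C (O' ∪ Z) : ℤ) - dblCov C O') := by
        refine Finset.sum_le_sum fun Z _ => ?_
        have hsub : (A.filter fun x => x ∈ dblCover C (O' ∪ Z)) ⊆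
            dblCover C (O' ∪ Z) \ dblCover C O' := fun x hx =>
          Finset.mem_sdiff.2 ⟨(Finset.mem_filter.1 hx).2,
            (Finset.mem_sdiff.1 (Finset.mem_filter.1 hx).1).2⟩
        have hle := Finset.card_le_card hsub
        have hadd := Finset.card_sdiff_add_card_eq_card
          (dblCover_mono C (Finset.subset_union_left (s₁ := O') (s₂ := Z)))
        rw [card_dblCover, card_dblCover] at hadd
        omega
end

section
/- Let X be a finite ground set, O a finite set of objects, and for each unordered pair {i,j} of objects (allowing i = j) let C(i,j) ⊆ X; for O' ⊆ O set c(O') = |⋃_{i,j ∈ O'} C(i,j)|. Let k and t be integers with 2 ≤ t ≤ k, let O* ⊆ O with |O*| = k, and let O' ⊆ O. Suppose Z' ⊆ O with |Z'| ≤ t maximizes c(O' ∪ Z) over all Z ⊆ O with |Z| ≤ t, and set O'' = O' ∪ Z'. Then c(O'') − c(O') ≥ (t(t−1))/(k(k−1)) · (c(O*) − c(O')). -/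
open Finset in
theorem choose_le_card_filter_powersetCard {α : Type*} [DecidableEq α] {s P : Finset α}
    (hP : P ⊆ s) {t : ℕ} (ht : P.card ≤ t) :
    (s.card - P.card).choose (t - P.card) ≤ ((s.powersetCard t).filter (P ⊆ ·)).card := by
  rw [← card_sdiff_of_subset hP, ← card_powersetCard]
  have hdisj : ∀ A ∈ powersetCard (t - P.card) (s \ P), Disjoint A P := fun A hA =>
    disjoint_of_subset_left (mem_powersetCard.1 hA).1 sdiff_disjoint
  refine card_le_card_of_injOn (· ∪ P) (fun A hA => ?_) fun A hA B hB h => ?_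
  · have hA' := mem_powersetCard.1 hA
    simp only [coe_filter, Set.mem_ofPred_eq, mem_powersetCard]
    refine ⟨⟨union_subset (hA'.1.trans sdiff_subset) hP, ?_⟩, subset_union_right⟩
    rw [card_union_of_disjoint (hdisj A hA), hA'.2, Nat.sub_add_cancel ht]
  · have h' : (A ∪ P) \ P = (B ∪ P) \ P := congrArg (· \ P) h
    rwa [union_sdiff_cancel_right (hdisj A hA), union_sdiff_cancel_right (hdisj B hB)] at h'

theorem Nat.choose_mul_mul_pred {k t : ℕ} (ht : 2 ≤ t) (htk : t ≤ k) :
    k.choose t * (t * (t - 1)) = (k - 2).choose (t - 2) * (k * (k - 1)) := by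
  obtain ⟨t, rfl⟩ := Nat.exists_eq_add_of_le' ht
  obtain ⟨k, rfl⟩ := Nat.exists_eq_add_of_le' (ht.trans htk)
  have h₁ := Nat.add_one_mul_choose_eq (k + 1) (t + 1)
  have h₂ := Nat.add_one_mul_choose_eq k t
  simp only [Nat.add_sub_cancel, Nat.add_succ_sub_one]
  zify at h₁ h₂ ⊢
  linear_combination -(t + 1 : ℤ) * h₁ - (k + 2 : ℤ) * h₂

/-- The set covered by the pairs of objects of `T`. -/
def dblCovSet {X O : Type*} [DecidableEq X] (C : O → O → Finset X) (T : Finset O) : Finset X :=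
  T.biUnion fun i => T.biUnion fun j => C i j

section dblCovSet

variable {X O : Type*} [DecidableEq X] {C : O → O → Finset X}

theorem mem_dblCovSet {T : Finset O} {x : X} :
    x ∈ dblCovSet C T ↔ ∃ i ∈ T, ∃ j ∈ T, x ∈ C i j := by
  simp [dblCovSet]

theorem dblCovSet_mono {S T : Finset O} (h : S ⊆ T) : dblCovSet C S ⊆ dblCovSet C T := by
  intro x hx
  obtain ⟨i, hi, j, hj, hx⟩ := mem_dblCovSet.1 hx
  exact mem_dblCovSet.2 ⟨i, h hi, j, h hj, hx⟩

/-- Double counting of the pairs of a newly covered element and a `t`-subset of `S` covering it. -/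
theorem card_sdiff_dblCovSet_mul_choose_le [DecidableEq O] {S T : Finset O} {t g : ℕ}
    (ht : 2 ≤ t) (htS : t ≤ S.card)
    (hg : ∀ Z : Finset O, Z.card ≤ t → dblCov C (T ∪ Z) ≤ dblCov C T + g) :
    (dblCovSet C S \ dblCovSet C T).card * (S.card - 2).choose (t - 2) ≤ S.card.choose t * g := by
  rw [← Finset.card_powersetCard]
  refine Finset.card_mul_le_card_mul (fun x Z => x ∈ dblCovSet C (T ∪ Z)) (fun x hx => ?_)
    fun Z hZ => ?_
  · obtain ⟨i, hi, j, hj, hx⟩ := mem_dblCovSet.1 (Finset.mem_sdiff.1 hx).1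
    have hij : ({i, j} : Finset O) ⊆ S := by
      simp [Finset.insert_subset_iff, hi, hj]
    obtain ⟨P, hijP, hPS, hP⟩ := Finset.exists_subsuperset_card_eq hij Finset.card_le_two
      (ht.trans htS)
    have h := choose_le_card_filter_powersetCard hPS (hP.trans_le ht)
    rw [hP] at h
    refine h.trans (Finset.card_le_card fun Z hZ => ?_)
    rw [Finset.mem_filter] at hZ
    have hijZ := hijP.trans (hZ.2.trans (Finset.subset_union_right (s₁ := T)))
    exact Finset.mem_bipartiteAbove _ |>.2
      ⟨hZ.1, mem_dblCovSet.2 ⟨i, hijZ (by simp), j, hijZ (by simp), hx⟩⟩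
  · have hsub : (dblCovSet C S \ dblCovSet C T).bipartiteBelow
        (fun x Z => x ∈ dblCovSet C (T ∪ Z)) Z ⊆ dblCovSet C (T ∪ Z) \ dblCovSet C T := by
      intro x hx
      obtain ⟨h₁, h₂⟩ := Finset.mem_bipartiteBelow _ |>.1 hx
      exact Finset.mem_sdiff.2 ⟨h₂, (Finset.mem_sdiff.1 h₁).2⟩
    refine (Finset.card_le_card hsub).trans ?_
    rw [Finset.card_sdiff_of_subset (dblCovSet_mono Finset.subset_union_left)]
    exact Nat.sub_le_iff_le_add'.2 (hg Z (Finset.mem_powersetCard.1 hZ).2.le)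

end dblCovSet

/-- the per-iteration guarantee of Greedy1. If `Z'` (of size at most `t`)
maximizes `c(O' ∪ Z)` over all `Z ⊆ O` with `|Z| ≤ t`, then the marginal gain of
`O'' = O' ∪ Z'` is at least `t(t-1)/(k(k-1))` times `c(O*) - c(O')`. -/
theorem stmt1 {X O : Type*} [Fintype X] [DecidableEq X] [Fintype O] [DecidableEq O]
    (C : O → O → Finset X) (hC : ∀ i j : O, C i j = C j i)
    (k t : ℕ) (ht : 2 ≤ t) (htk : t ≤ k)
    (Ostar : Finset O) (hOstar : Ostar.card = k) (O' : Finset O)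
    (Z' : Finset O) (hZ'card : Z'.card ≤ t)
    (hZ'max : ∀ Z : Finset O, Z.card ≤ t → dblCov C (O' ∪ Z) ≤ dblCov C (O' ∪ Z')) :
    (dblCov C (O' ∪ Z') : ℝ) - (dblCov C O' : ℝ) ≥
      ((t : ℝ) * ((t : ℝ) - 1)) / ((k : ℝ) * ((k : ℝ) - 1)) *
        ((dblCov C Ostar : ℝ) - (dblCov C O' : ℝ)) := by
  subst hOstar
  obtain ⟨g, hg⟩ : ∃ g, dblCov C (O' ∪ Z') = dblCov C O' + g :=
    Nat.exists_eq_add_of_le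
      (Finset.card_le_card (dblCovSet_mono (C := C) Finset.subset_union_left))
  have hcount := card_sdiff_dblCovSet_mul_choose_le ht htk
    fun Z hZ => (hZ'max Z hZ).trans_eq hg
  have hsdiff : dblCov C Ostar ≤ dblCov C O' + (dblCovSet C Ostar \ dblCovSet C O').card :=
    Nat.sub_le_iff_le_add'.1 (Finset.le_card_sdiff (dblCovSet C O') (dblCovSet C Ostar))
  have hchoose := Nat.choose_mul_mul_pred ht htk
  generalize (dblCovSet C Ostar \ dblCovSet C O').card = d at hcount hsdiff
  have hpos : 0 < (Ostar.card).choose t := Nat.choose_pos htk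
  have hmul : t * (t - 1) * d ≤ g * (Ostar.card * (Ostar.card - 1)) := by
    refine Nat.le_of_mul_le_mul_left ?_ hpos
    calc Ostar.card.choose t * (t * (t - 1) * d)
        = d * (Ostar.card - 2).choose (t - 2) * (Ostar.card * (Ostar.card - 1)) := by
          rw [← mul_assoc, hchoose]; ring
      _ ≤ Ostar.card.choose t * g * (Ostar.card * (Ostar.card - 1)) := by gcongr
      _ = _ := by ring
  have hmul' : (t : ℝ) * (t - 1) * d ≤ g * (Ostar.card * (Ostar.card - 1)) := by
    have := (Nat.cast_le (α := ℝ)).2 hmul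
    push_cast [Nat.cast_sub (show 1 ≤ t by omega),
      Nat.cast_sub (show 1 ≤ Ostar.card by omega)] at this
    exact this
  have hsdiff' : (dblCov C Ostar : ℝ) - dblCov C O' ≤ d := by
    rw [sub_le_iff_le_add']; exact_mod_cast hsdiff
  have ht' : (2 : ℝ) ≤ t := by exact_mod_cast ht
  have hk' : (2 : ℝ) ≤ Ostar.card := by exact_mod_cast ht.trans htk
  rw [ge_iff_le, hg, Nat.cast_add, add_sub_cancel_left, div_mul_eq_mul_div,
    div_le_iff₀ (mul_pos (by linarith) (by linarith))]
  exact (mul_le_mul_of_nonneg_left hsdiff' (mul_nonneg (by linarith) (by linarith))).trans hmul'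
end

section
/- Let X be a finite set, O a finite set, and N : O → Finset X an assignment of finite subsets of X to elements of O; for T ⊆ O set d(T) = |⋃_{o ∈ T} N(o)|. Then for every S ⊆ O with |S| = k ≥ 1 there exists T ⊆ S with |T| = ⌈k/2⌉ and 2 · d(T) ≥ d(S). -/
/-- for `d(T) = |⋃_{o ∈ T} N(o)|`, every `S` with `|S| = k ≥ 1` contains a
subset `T` of size `⌈k/2⌉` with `2·d(T) ≥ d(S)`. -/
theorem stmt5 {X O : Type*} [Fintype X] [DecidableEq X] [Fintype O] [DecidableEq O]
    (N : O → Finset X) (k : ℕ) (hk : 1 ≤ k) (S : Finset O) (hS : S.card = k) :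
    ∃ T ⊆ S, T.card = (k + 1) / 2 ∧ 2 * (T.biUnion N).card ≥ (S.biUnion N).card := by
  obtain ⟨A, hAS, hA⟩ := Finset.exists_subset_card_eq (show (k + 1) / 2 ≤ S.card by lia)
  have hdiff : (S \ A).card = k - (k + 1) / 2 := by
    rw [Finset.card_sdiff_of_subset hAS, hS, hA]
  obtain ⟨B, hAB, hBS, hB⟩ := Finset.exists_subsuperset_card_eq
    (Finset.sdiff_subset : S \ A ⊆ S) (show (S \ A).card ≤ (k + 1) / 2 by lia)
    (show (k + 1) / 2 ≤ S.card by lia)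
  have hsub : S.biUnion N ⊆ A.biUnion N ∪ B.biUnion N := by
    rw [← Finset.union_biUnion]
    exact Finset.biUnion_subset_biUnion_of_subset_left N (by grind)
  have hcard := (Finset.card_le_card hsub).trans (Finset.card_union_le _ _)
  rcases le_total (B.biUnion N).card (A.biUnion N).card with h | h
  · exact ⟨A, hAS, hA, by lia⟩
  · exact ⟨B, hBS, hB, by lia⟩
end

section
/- Let X be a finite ground set, O a finite set of objects, and for each unordered pair {i,j} of objects (allowing i = j) let C(i,j) ⊆ X; for O' ⊆ O set c(O') = |⋃_{i,j ∈ O'} C(i,j)|, N(O') = ⋃_{o ∈ O', i ∈ O} C(o,i) and d(O') = |N(O')|. Let k be an integer with 1 ≤ k ≤ |O|, let O* ⊆ O with |O*| = k, and let H ⊆ O with |H| = ⌈k/2⌉ satisfy d(H) ≥ (1 − 1/e) · d(H*) for every H* ⊆ O with |H*| = ⌈k/2⌉. Then d(H) ≥ (1/2) · (1 − 1/e) · c(O*). -/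
/-- The degree `d(O') = |N(O')| = |⋃_{o ∈ O', i ∈ O} C(o,i)|` of a set of objects. -/
def deg {X O : Type*} [Fintype O] [DecidableEq X] (C : O → O → Finset X) (T : Finset O) : ℕ :=
  (T.biUnion fun o => Finset.univ.biUnion fun i => C o i).card

theorem dblCov_le_deg {X O : Type*} [Fintype O] [DecidableEq X]
    (C : O → O → Finset X) (T : Finset O) : dblCov C T ≤ deg C T :=
  Finset.card_le_card <| Finset.biUnion_mono fun _ _ =>
    Finset.biUnion_subset_biUnion_of_subset_left _ (Finset.subset_univ T)

theorem deg_union_le {X O : Type*} [Fintype O] [DecidableEq X] [DecidableEq O]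
    (C : O → O → Finset X) (S T : Finset O) : deg C (S ∪ T) ≤ deg C S + deg C T := by
  unfold deg
  rw [Finset.union_biUnion]
  exact Finset.card_union_le _ _

/-- A finite set is the union of two subsets whose size is half its own, rounded up. -/
theorem Finset.exists_union_eq_card_half {α : Type*} [DecidableEq α] (S : Finset α) :
    ∃ A B : Finset α, A ∪ B = S ∧ A.card = (S.card + 1) / 2 ∧ B.card = (S.card + 1) / 2 := by
  obtain ⟨A, hAS, hA⟩ := Finset.exists_subset_card_eq (show (S.card + 1) / 2 ≤ S.card by omega)
  have hdiff : (S \ A).card ≤ (S.card + 1) / 2 := by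
    rw [Finset.card_sdiff_of_subset hAS]
    omega
  obtain ⟨B, hSB, hBS, hB⟩ := Finset.exists_subsuperset_card_eq
    (Finset.sdiff_subset : S \ A ⊆ S) hdiff (by omega)
  refine ⟨A, B, (Finset.union_subset hAS hBS).antisymm fun x hx => ?_, hA, hB⟩
  by_cases hxA : x ∈ A
  · exact Finset.mem_union_left _ hxA
  · exact Finset.mem_union_right _ (hSB (Finset.mem_sdiff.2 ⟨hx, hxA⟩))

/-- Lemma 2: if `H` of size `⌈k/2⌉` is a `(1-1/e)`-approximate degree
maximizer, then `d(H) ≥ (1/2)(1-1/e)·c(O*)` for any `O*` of size `k`. -/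
theorem stmt6 {X O : Type*} [Fintype X] [DecidableEq X] [Fintype O] [DecidableEq O]
    (C : O → O → Finset X) (hC : ∀ i j : O, C i j = C j i)
    (k : ℕ) (hk1 : 1 ≤ k) (hk2 : k ≤ Fintype.card O)
    (Ostar : Finset O) (hOstar : Ostar.card = k)
    (H : Finset O) (hHcard : H.card = (k + 1) / 2)
    (hH : ∀ Hstar : Finset O, Hstar.card = (k + 1) / 2 →
      (deg C H : ℝ) ≥ (1 - (Real.exp 1)⁻¹) * (deg C Hstar : ℝ)) :
    (deg C H : ℝ) ≥ (1 / 2) * (1 - (Real.exp 1)⁻¹) * (dblCov C Ostar : ℝ) := by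
  obtain ⟨A, B, hAB, hA, hB⟩ := Ostar.exists_union_eq_card_half
  rw [hOstar] at hA hB
  have hcov : (dblCov C Ostar : ℝ) ≤ deg C A + deg C B := by
    rw [← hAB]
    exact_mod_cast (dblCov_le_deg C (A ∪ B)).trans (deg_union_le C A B)
  have hpos : (0 : ℝ) ≤ 1 - (Real.exp 1)⁻¹ :=
    sub_nonneg.2 (inv_le_one_of_one_le₀ (Real.one_le_exp zero_le_one))
  linarith [hH A hA, hH B hB, mul_le_mul_of_nonneg_left hcov hpos]
end

section
/- Let X be a finite ground set, O a finite set of objects, and for each unordered pair {i,j} of objects (allowing i = j) let C(i,j) ⊆ X; for O' ⊆ O set C̄(O') = ⋃_{i,j ∈ O'} C(i,j), c(O') = |C̄(O')|, N(O') = ⋃_{o ∈ O', i ∈ O} C(o,i), d(O') = |N(O')|, and D(O') = N(O') \ C̄(O'). Let H ⊆ O and let k be an integer with 1 ≤ ⌊k/2⌋ ≤ |O \ H|. Then there exists I* ⊆ O \ H with |I*| = ⌊k/2⌋ such that |D(H) ∩ N(I*)| ≥ (d(H) − c(H)) · ⌊k/2⌋ / |O|. -/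
/-- The set of double covered elements `C̄(O') = ⋃_{i,j ∈ O'} C(i,j)`. -/
def covSet {X O : Type*} [DecidableEq X] (C : O → O → Finset X) (T : Finset O) : Finset X :=
  T.biUnion fun i => T.biUnion fun j => C i j

/-- The set of single covered elements `N(O') = ⋃_{o ∈ O', i ∈ O} C(o,i)`. -/
def nSet {X O : Type*} [Fintype O] [DecidableEq X] (C : O → O → Finset X) (T : Finset O) :
    Finset X :=
  T.biUnion fun o => Finset.univ.biUnion fun i => C o i

/-- The `m` heaviest elements of a finite set carry at least the average weight. -/
theorem exists_subset_card_eq_mul_sum_le {ι : Type*} [DecidableEq ι] (w : ι → ℝ) (m : ℕ)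
    (U : Finset ι) (hm : m ≤ U.card) :
    ∃ S ⊆ U, S.card = m ∧ (m : ℝ) * ∑ i ∈ U, w i ≤ U.card * ∑ i ∈ S, w i := by
  induction hn : U.card - m generalizing U with
  | zero =>
    have h : U.card = m := by omega
    exact ⟨U, Finset.Subset.refl _, h, by rw [h]⟩
  | succ n ih =>
    obtain rfl | hm0 := Nat.eq_zero_or_pos m
    · exact ⟨∅, by simp, by simp, by simp⟩
    have hU : U.Nonempty := Finset.card_pos.mp (by omega)
    obtain ⟨a, ha, hmin⟩ := U.exists_min_image w hU
    have hcard := Finset.card_erase_add_one ha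
    obtain ⟨S, hS, hSm, hle⟩ := ih (U.erase a) (by omega) (by omega)
    refine ⟨S, hS.trans (Finset.erase_subset _ _), hSm, ?_⟩
    have hsum := Finset.sum_erase_add U w ha
    have hmS : (m : ℝ) * w a ≤ ∑ i ∈ S, w i := by
      have := Finset.card_nsmul_le_sum S w (w a)
        fun i hi => hmin i (Finset.mem_of_mem_erase (hS hi))
      simpa [hSm] using this
    rw [← hsum, ← hcard]
    push_cast
    linarith

/-- there is a set `I*` of `⌊k/2⌋` objects outside `H` whose neighborhood
meets `D(H) = N(H) \ C̄(H)` in at least `(d(H) - c(H))·⌊k/2⌋/|O|` elements. -/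
theorem stmt7 {X O : Type*} [Fintype X] [DecidableEq X] [Fintype O] [DecidableEq O]
    (C : O → O → Finset X) (hC : ∀ i j : O, C i j = C j i)
    (H : Finset O) (k : ℕ) (hk1 : 1 ≤ k / 2) (hk2 : k / 2 ≤ (Finset.univ \ H).card) :
    ∃ Istar : Finset O, Istar ⊆ Finset.univ \ H ∧ Istar.card = k / 2 ∧
      (((nSet C H \ covSet C H) ∩ nSet C Istar).card : ℝ) ≥
        (((nSet C H).card : ℝ) - ((covSet C H).card : ℝ)) * ((k / 2 : ℕ) : ℝ) /
          (Fintype.card O : ℝ) := by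
  classical
  set D := nSet C H \ covSet C H with hD
  have hcov : ∀ x, ∃ i, x ∈ D → i ∈ Finset.univ \ H ∧ ∃ j, x ∈ C i j := by
    intro x
    by_cases hx : x ∈ D
    · simp only [hD, nSet, covSet, Finset.mem_sdiff, Finset.mem_biUnion, Finset.mem_univ,
        true_and, not_exists, not_and] at hx
      obtain ⟨⟨o, ho, i, hi⟩, hnot⟩ := hx
      refine ⟨i, fun _ => ⟨?_, o, hC o i ▸ hi⟩⟩
      simpa using fun hiH => hnot o ho i hiH hi
    · obtain ⟨i, -⟩ := Finset.card_pos.mp (hk1.trans hk2)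
      exact ⟨i, fun h => absurd h hx⟩
  choose g hg using hcov
  obtain ⟨S, hS, hSm, hle⟩ := exists_subset_card_eq_mul_sum_le
    (fun i => ((D.filter fun x => g x = i).card : ℝ)) (k / 2) (Finset.univ \ H) hk2
  refine ⟨S, hS, hSm, ?_⟩
  have htotal : (D.card : ℝ) = ∑ i ∈ Finset.univ \ H, ((D.filter fun x => g x = i).card : ℝ) := by
    exact_mod_cast Finset.card_eq_sum_card_fiberwise fun x hx => (hg x hx).1
  have hfiber : ∑ i ∈ S, ((D.filter fun x => g x = i).card : ℝ) ≤ ((D ∩ nSet C S).card : ℝ) := by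
    have hmaps : ∀ x ∈ D.filter (fun x => g x ∈ S), g x ∈ S :=
      fun x hx => (Finset.mem_filter.mp hx).2
    have hsub : D.filter (fun x => g x ∈ S) ⊆ D ∩ nSet C S := by
      intro x hx
      obtain ⟨hxD, hxS⟩ := Finset.mem_filter.mp hx
      obtain ⟨j, hj⟩ := (hg x hxD).2
      simp only [nSet, Finset.mem_inter, Finset.mem_biUnion, Finset.mem_univ, true_and]
      exact ⟨hxD, g x, hxS, j, hj⟩
    have hsum : ∑ i ∈ S, (D.filter fun x => g x = i).card
        = (D.filter fun x => g x ∈ S).card := by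
      rw [Finset.card_eq_sum_card_fiberwise hmaps]
      refine Finset.sum_congr rfl fun i hi => congrArg Finset.card ?_
      ext x
      simp only [Finset.mem_filter]
      grind
    exact_mod_cast hsum.trans_le (Finset.card_le_card hsub)
  have hdc : ((nSet C H).card : ℝ) - (covSet C H).card ≤ D.card := by
    have := Finset.le_card_sdiff (covSet C H) (nSet C H)
    rw [sub_le_iff_le_add]
    exact_mod_cast Nat.sub_le_iff_le_add.mp this
  have hUO : (((Finset.univ \ H).card : ℕ) : ℝ) ≤ Fintype.card O := by
    exact_mod_cast Finset.card_le_univ (Finset.univ \ H)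
  have hO : (0 : ℝ) < Fintype.card O :=
    lt_of_lt_of_le (Nat.cast_pos.mpr (hk1.trans hk2)) hUO
  rw [ge_iff_le, div_le_iff₀ hO]
  calc _ ≤ (D.card : ℝ) * ((k / 2 : ℕ) : ℝ) := by gcongr
    _ = ((k / 2 : ℕ) : ℝ) * ∑ i ∈ Finset.univ \ H, ((D.filter fun x => g x = i).card : ℝ) := by
      rw [htotal, mul_comm]
    _ ≤ _ := hle
    _ ≤ (Fintype.card O : ℝ) * ((D ∩ nSet C S).card : ℝ) :=
      mul_le_mul hUO hfiber (Finset.sum_nonneg fun _ _ => Nat.cast_nonneg _) hO.le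
    _ = _ := mul_comm _ _
end

section
/- Let a, b, c* be real numbers with c* ≥ 0, let k, t be integers with 2 ≤ t ≤ k, let m be a real number with m ≥ k > 1, and let ε ∈ (0,1). Suppose a ≥ (1 − e^{−(1−ε)(t−1)/(k−1)}) · c* and b ≥ (1−ε) · (1/4) · (1 − 1/e)² · (k/m) · c*. Then max(a, b) ≥ (1−ε) · (1/2) · (1 − 1/e)^{3/2} · √((t−1)/m) · c*. -/
/-- On `[0, 1]` the concave function `1 - exp (-x)` lies above its chord. -/
theorem one_sub_exp_neg_one_mul_le {x : ℝ} (hx0 : 0 ≤ x) (hx1 : x ≤ 1) :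
    (1 - (Real.exp 1)⁻¹) * x ≤ 1 - Real.exp (-x) := by
  have h := convexOn_exp.2 (Set.mem_univ (0 : ℝ)) (Set.mem_univ (-1 : ℝ))
    (sub_nonneg.2 hx1) hx0 (sub_add_cancel 1 x)
  simp only [smul_eq_mul, mul_zero, zero_add, mul_neg, mul_one, Real.exp_zero,
    Real.exp_neg 1] at h
  linarith

/-- The maximum of two nonnegative numbers is at least their geometric mean. -/
theorem le_max_of_sq_le_mul_of_nonneg {a b r : ℝ} (ha : 0 ≤ a) (hb : 0 ≤ b)
    (hr : r ^ 2 ≤ a * b) : r ≤ max a b := by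
  refine le_of_sq_le_sq ?_ (le_max_of_le_left ha)
  calc r ^ 2 ≤ a * b := hr
    _ ≤ max a b * max a b := by gcongr <;> simp
    _ = max a b ^ 2 := (sq _).symm

/-- Theorem 3 of the paper: combining the guarantees of Greedy1 and Greedy2. -/
theorem stmt10 (a b cstar : ℝ) (hcstar : 0 ≤ cstar) (k t : ℤ) (ht : 2 ≤ t) (htk : t ≤ k)
    (m : ℝ) (hmk : (k : ℝ) ≤ m) (hk1 : (1 : ℝ) < (k : ℝ)) (ε : ℝ) (hε0 : 0 < ε) (hε1 : ε < 1)
    (ha : a ≥ (1 - Real.exp (-((1 - ε) * ((t : ℝ) - 1) / ((k : ℝ) - 1)))) * cstar)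
    (hb : b ≥ (1 - ε) * (1 / 4) * (1 - (Real.exp 1)⁻¹) ^ 2 * ((k : ℝ) / m) * cstar) :
    max a b ≥
      (1 - ε) * (1 / 2) * (1 - (Real.exp 1)⁻¹) ^ ((3 : ℝ) / 2) *
        Real.sqrt (((t : ℝ) - 1) / m) * cstar := by
  have ht' : (0 : ℝ) < (t : ℝ) - 1 := by
    have : (2 : ℝ) ≤ t := by exact_mod_cast ht
    linarith
  have htk' : (t : ℝ) ≤ k := by exact_mod_cast htk
  have hk : (0 : ℝ) < (k : ℝ) - 1 := sub_pos.2 hk1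
  have hk0 : (0 : ℝ) < k := by linarith
  have hm : 0 < m := by linarith
  have hε : 0 < 1 - ε := sub_pos.2 hε1
  have hq : 0 ≤ 1 - (Real.exp 1)⁻¹ :=
    sub_nonneg.2 (inv_le_one_of_one_le₀ (Real.one_le_exp zero_le_one))
  have hx0 : 0 ≤ (1 - ε) * ((t : ℝ) - 1) / ((k : ℝ) - 1) := by positivity
  have hx1 : (1 - ε) * ((t : ℝ) - 1) / ((k : ℝ) - 1) ≤ 1 := by
    rw [div_le_one hk]
    nlinarith
  have hchord := one_sub_exp_neg_one_mul_le hx0 hx1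
  generalize 1 - (Real.exp 1)⁻¹ = q at *
  have hq3 : (q ^ ((3 : ℝ) / 2)) ^ 2 = q ^ 3 := by
    rw [← Real.rpow_mul_natCast hq, ← Real.rpow_natCast]
    norm_num
  refine le_trans (le_max_of_sq_le_mul_of_nonneg (by positivity) (by positivity) ?_)
    (max_le_max ((mul_le_mul_of_nonneg_right hchord hcstar).trans ha) hb)
  have hratio : 1 ≤ (k : ℝ) / ((k : ℝ) - 1) := (one_le_div hk).2 (by linarith)
  calc ((1 - ε) * (1 / 2) * q ^ ((3 : ℝ) / 2) * √(((t : ℝ) - 1) / m) * cstar) ^ 2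
      = (1 - ε) ^ 2 * (1 / 4) * q ^ 3 * (((t : ℝ) - 1) / m) * cstar ^ 2 := by
        rw [mul_pow, mul_pow, mul_pow, hq3, Real.sq_sqrt (by positivity)]
        ring
    _ ≤ (1 - ε) ^ 2 * (1 / 4) * q ^ 3 * (((t : ℝ) - 1) / m) * cstar ^ 2 *
          ((k : ℝ) / ((k : ℝ) - 1)) := le_mul_of_one_le_right (by positivity) hratio
    _ = _ := by ring
end
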